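/- Let G be a finite simple graph with independence number 3, let a₁ be the number of vertices of G, a₂ the number of 2-element independent sets, and a₃ the number of 3-element independent sets, and let P(z) = a₁z + a₂z² + a₃z³ as a map ℂ → ℂ. If a₂² > 3·a₁·a₃, a₂² = 4·a₃·(a₁ − 1), and a₁ > 5, then the Julia set J(P) is not connected, but it is not totally disconnected (it contains a connected subset with at least two distinct points). -/

import Mathlib

theorem exists_continuous_log_of_totallyDisconnected {X : Type*} [TopologicalSpace X]
    [CompactSpace X] [T2Space X] [TotallyDisconnectedSpace X] {g : X → ℂ}
    (hg : Continuous g) (h0 : ∀ x, g x ≠ 0) :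
    ∃ h : X → ℂ, Continuous h ∧ ∀ x, Complex.exp (h x) = g x := by
  suffices H : ∃ C : Set X, IsClopen C ∧ Set.univ ⊆ C ∧
      ∃ h : X → ℂ, Continuous h ∧ ∀ x ∈ C, Complex.exp (h x) = g x by
    obtain ⟨C, -, hC, h, hc, hh⟩ := H
    exact ⟨h, hc, fun x => hh x (hC trivial)⟩
  refine isCompact_univ.induction_on (p := fun s => ∃ C : Set X, IsClopen C ∧ s ⊆ C ∧
      ∃ h : X → ℂ, Continuous h ∧ ∀ x ∈ C, Complex.exp (h x) = g x) ?_ ?_ ?_ ?_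
  · exact ⟨∅, isClopen_empty, subset_rfl, 0, continuous_const, by simp⟩
  · rintro s t hst ⟨C, hC, hsC, h⟩
    exact ⟨C, hC, hst.trans hsC, h⟩
  · rintro s t ⟨C, hC, hsC, h, hc, hh⟩ ⟨D, hD, htD, k, kc, hk⟩
    classical
    refine ⟨C ∪ D, hC.union hD, Set.union_subset_union hsC htD, C.piecewise h k,
      continuous_piecewise (by simp [hC.frontier_eq]) hc.continuousOn kc.continuousOn, ?_⟩
    intro x hx
    by_cases hxC : x ∈ C
    · simp [hxC, hh x hxC]
    · simp [hxC, hk x (hx.resolve_left hxC)]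
  · intro x _
    have hev : {y | g y / g x ∈ Complex.slitPlane} ∈ nhds x := by
      refine (hg.div_const (g x)).continuousAt.preimage_mem_nhds
        (Complex.isOpen_slitPlane.mem_nhds ?_)
      simp [div_self (h0 x)]
    obtain ⟨C, ⟨hxC, hC⟩, hCs⟩ := (nhds_basis_clopen x).mem_iff.mp hev
    classical
    refine ⟨C, mem_nhdsWithin_of_mem_nhds (hC.isOpen.mem_nhds hxC), C, hC, subset_rfl,
      C.piecewise (fun y => Complex.log (g y / g x) + Complex.log (g x)) 0,
      continuous_piecewise (by simp [hC.frontier_eq]) ?_ continuousOn_const, ?_⟩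
    · rw [hC.isClosed.closure_eq]
      exact ((hg.div_const _).continuousOn.clog fun y hy => hCs hy).add continuousOn_const
    · intro y hy
      simp only [hy, Set.piecewise_eq_of_mem]
      rw [Complex.exp_add, Complex.exp_log (div_ne_zero (h0 y) (h0 x)), Complex.exp_log (h0 x),
        div_mul_cancel₀ _ (h0 x)]

theorem not_exists_continuous_log_sub {S : Set ℂ} (hS : Bornology.IsBounded S) (p : ℂ)
    {H : ℂ → ℂ} (hH : Continuous H) (h : ∀ z ∉ S, Complex.exp (H z) = z - p) : False := by
  obtain ⟨R, hR0, hR⟩ := hS.subset_ball_lt 0 p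
  have hout : ∀ θ : ℝ, p + R * Complex.exp (θ * Complex.I) ∉ S := by
    intro θ hθ
    have := hR hθ
    simp [Complex.norm_exp_ofReal_mul_I, abs_of_pos hR0] at this
  have key := Complex.isCoveringMap_exp.eq_of_comp_eq
    (g₁ := fun θ : ℝ => H (p + R * Complex.exp (θ * Complex.I)))
    (g₂ := fun θ : ℝ => H (p + R) + θ * Complex.I) (by fun_prop) (by fun_prop) (by
      ext θ
      have h0 := h _ (hout 0)
      simp only [Function.comp_apply]
      rw [h _ (hout θ), Complex.exp_add]
      simp only [Complex.ofReal_zero, zero_mul, Complex.exp_zero, mul_one] at h0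
      rw [h0]
      ring) 0 (by simp)
  have h2 := congrFun key (2 * Real.pi)
  simp [Complex.exp_two_pi_mul_I, Real.pi_ne_zero] at h2

theorem not_isTotallyDisconnected_frontier {S : Set ℂ} (hS : Bornology.IsBounded S)
    (hne : (interior S).Nonempty) : ¬ IsTotallyDisconnected (frontier S) := by
  intro htd
  obtain ⟨p, hp⟩ := hne
  have hcomp : IsCompact (frontier S) :=
    hS.isCompact_closure.of_isClosed_subset isClosed_frontier frontier_subset_closure
  have := isCompact_iff_compactSpace.mp hcomp
  have := totallyDisconnectedSpace_subtype_iff.mpr htd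
  have hpf : p ∉ frontier S := fun h => h.2 hp
  obtain ⟨h, hc, hh⟩ := exists_continuous_log_of_totallyDisconnected
    (X := frontier S) (g := fun z => (z : ℂ) - p) (by fun_prop)
    (fun z hz => hpf (sub_eq_zero.mp hz ▸ z.2))
  obtain ⟨k, hk⟩ := ContinuousMap.exists_restrict_eq isClosed_frontier (⟨h, hc⟩ : C(frontier S, ℂ))
  have hk' : ∀ z ∈ frontier S, Complex.exp (k z) = z - p := by
    intro z hz
    have := DFunLike.congr_fun hk ⟨z, hz⟩
    simp only [ContinuousMap.restrict_apply, ContinuousMap.coe_mk] at this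
    rw [this, hh]
  classical
  let F : C(ℂ, ℂ) := ⟨S.piecewise (fun z => Complex.exp (k z)) (fun z => z - p),
    Continuous.piecewise hk' (by fun_prop) (by fun_prop)⟩
  have hF : ∀ z, F z ∈ ({0}ᶜ : Set ℂ) := by
    intro z
    by_cases hz : z ∈ S
    · simp [F, hz]
    · have : z ≠ p := fun e => hz (e ▸ interior_subset hp)
      simp [F, hz, sub_eq_zero, this]
  obtain ⟨H, ⟨-, hH⟩, -⟩ := Complex.isCoveringMapOn_exp.existsUnique_continuousMap_lifts F
    (a₀ := 0) (e₀ := Complex.log (F 0)) (Complex.exp_log (hF 0)) hF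
  refine not_exists_continuous_log_sub hS p H.continuous fun z hz => ?_
  have := congrFun hH z
  simpa [F, hz] using this

/-- The filled-in Julia set of a map: the points with bounded forward orbit. -/
def filledJulia (f : ℂ → ℂ) : Set ℂ :=
  {z | Bornology.IsBounded (Set.range fun n => f^[n] z)}

theorem mem_filledJulia {f : ℂ → ℂ} {z : ℂ} :
    z ∈ filledJulia f ↔ Bornology.IsBounded (Set.range fun n => f^[n] z) := Iff.rfl

theorem filledJulia_eq_setOf_norm_iterate_le {f : ℂ → ℂ} {R : ℝ} (hR : 0 < R)
    (hf : ∀ z, R ≤ ‖z‖ → 2 * ‖z‖ ≤ ‖f z‖) :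
    filledJulia f = {z | ∀ n, ‖f^[n] z‖ ≤ R} := by
  ext z
  refine ⟨fun hz n => ?_, fun hz => ?_⟩
  · by_contra! hn
    have hgrow : ∀ m : ℕ, 2 ^ m * R ≤ ‖f^[m + n] z‖ := by
      intro m
      induction m with
      | zero => simpa using hn.le
      | succ m ih =>
        have h1 : R ≤ ‖f^[m + n] z‖ :=
          (le_mul_of_one_le_left hR.le (one_le_pow₀ one_le_two)).trans ih
        rw [Nat.add_right_comm, Function.iterate_succ_apply', pow_succ']
        linarith [hf _ h1]
    obtain ⟨C, hC⟩ := isBounded_iff_forall_norm_le.mp (mem_filledJulia.mp hz)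
    obtain ⟨m, hm⟩ := pow_unbounded_of_one_lt (C / R) one_lt_two
    rw [div_lt_iff₀ hR] at hm
    linarith [hgrow m, hC _ ⟨m + n, rfl⟩]
  · exact mem_filledJulia.mpr <| isBounded_iff_forall_norm_le.mpr ⟨R, by rintro _ ⟨n, rfl⟩; exact hz n⟩

theorem mem_filledJulia_of_apply_eq {f : ℂ → ℂ} {z : ℂ} (hz : f z = z) : z ∈ filledJulia f := by
  simp [filledJulia, Function.iterate_fixed hz]

theorem apply_mem_filledJulia {f : ℂ → ℂ} {z : ℂ} (hz : z ∈ filledJulia f) :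
    f z ∈ filledJulia f := by
  refine mem_filledJulia.mpr <| (mem_filledJulia.mp hz).subset ?_
  rintro _ ⟨n, rfl⟩
  exact ⟨n + 1, rfl⟩

section ParabolicCubic

variable {a c : ℝ} {f : ℂ → ℂ}

theorem two_mul_norm_le_norm_parabolicCubic (hc : 0 < c) (hac : 4 < a * c ^ 2)
    (hf : ∀ z, f z = z + a * z * (z + c) ^ 2) {z : ℂ} (hz : 2 * c ≤ ‖z‖) :
    2 * ‖z‖ ≤ ‖f z‖ := by
  have ha : 0 < a := pos_of_mul_pos_left (by linarith) (sq_nonneg c)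
  have h1 : c ≤ ‖z + c‖ := by
    have := norm_sub_le (z + c) c
    rw [add_sub_cancel_right, Complex.norm_real, Real.norm_of_nonneg hc.le] at this
    linarith
  have h2 : 4 ≤ ‖(a : ℂ) * (z + c) ^ 2‖ := by
    rw [norm_mul, norm_pow, Complex.norm_real, Real.norm_of_nonneg ha.le]
    exact hac.le.trans (by gcongr)
  have h3 : 2 ≤ ‖1 + (a : ℂ) * (z + c) ^ 2‖ := by
    have := norm_sub_le (1 + (a : ℂ) * (z + c) ^ 2) 1
    rw [add_sub_cancel_left, norm_one] at this
    linarith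
  have h4 : f z = (1 + (a : ℂ) * (z + c) ^ 2) * z := by rw [hf]; ring
  rw [h4, norm_mul]
  gcongr

theorem filledJulia_parabolicCubic_eq (hc : 0 < c) (hac : 4 < a * c ^ 2)
    (hf : ∀ z, f z = z + a * z * (z + c) ^ 2) :
    filledJulia f = {z | ∀ n, ‖f^[n] z‖ ≤ 2 * c} :=
  filledJulia_eq_setOf_norm_iterate_le (by positivity)
    fun _ => two_mul_norm_le_norm_parabolicCubic hc hac hf

theorem isClosed_filledJulia_parabolicCubic (hc : 0 < c) (hac : 4 < a * c ^ 2)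
    (hf : ∀ z, f z = z + a * z * (z + c) ^ 2) : IsClosed (filledJulia f) := by
  have hcont : Continuous f := by rw [funext hf]; fun_prop
  rw [filledJulia_parabolicCubic_eq hc hac hf, Set.ofPred_forall]
  exact isClosed_iInter fun n => isClosed_le (hcont.iterate n).norm continuous_const

theorem isBounded_filledJulia_parabolicCubic (hc : 0 < c) (hac : 4 < a * c ^ 2)
    (hf : ∀ z, f z = z + a * z * (z + c) ^ 2) : Bornology.IsBounded (filledJulia f) :=
  isBounded_iff_forall_norm_le.mpr ⟨2 * c, fun z hz => by
    rw [filledJulia_parabolicCubic_eq hc hac hf] at hz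
    exact hz 0⟩

theorem ofReal_notMem_filledJulia_of_pos (hc : 0 < c) (ha : 0 < a)
    (hf : ∀ z, f z = z + a * z * (z + c) ^ 2) {x : ℝ} (hx : 0 < x) :
    (x : ℂ) ∉ filledJulia f := by
  intro hz
  have hgrow : ∀ n : ℕ, ∃ y : ℝ, f^[n] x = y ∧ x + n * (a * x * c ^ 2) ≤ y := by
    intro n
    induction n with
    | zero => exact ⟨x, by simp⟩
    | succ n ih =>
      obtain ⟨y, hy, hxy⟩ := ih
      refine ⟨y + a * y * (y + c) ^ 2, by
        rw [Function.iterate_succ_apply', hy, hf]; push_cast; ring, ?_⟩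
      have h0 : x ≤ y := le_trans (le_add_of_nonneg_right (by positivity)) hxy
      have h1 : a * x * c ^ 2 ≤ a * y * (y + c) ^ 2 := by
        have : 0 < y := hx.trans_le h0
        gcongr
        linarith
      push_cast
      linarith
  obtain ⟨C, hC⟩ := isBounded_iff_forall_norm_le.mp (mem_filledJulia.mp hz)
  obtain ⟨n, hn⟩ := exists_nat_gt (C / (a * x * c ^ 2))
  rw [div_lt_iff₀ (by positivity)] at hn
  obtain ⟨y, hy, hxy⟩ := hgrow n
  have h2 := hC _ ⟨n, hy⟩
  rw [Complex.norm_real] at h2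
  linarith [Real.le_norm_self y]

theorem ofReal_notMem_filledJulia_of_lt_neg (hc : 0 < c) (ha : 0 < a)
    (hf : ∀ z, f z = z + a * z * (z + c) ^ 2) {x : ℝ} (hx : x < -c) :
    (x : ℂ) ∉ filledJulia f := by
  intro hz
  have hd : 0 < -(x + c) := by linarith
  have hgrow : ∀ n : ℕ, ∃ y : ℝ, f^[n] x = y ∧ y ≤ x - n * (a * c * (-(x + c)) ^ 2) := by
    intro n
    induction n with
    | zero => exact ⟨x, by simp⟩
    | succ n ih =>
      obtain ⟨y, hy, hxy⟩ := ih
      refine ⟨y + a * y * (y + c) ^ 2, by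
        rw [Function.iterate_succ_apply', hy, hf]; push_cast; ring, ?_⟩
      have h0 : y ≤ x := hxy.trans (sub_le_self _ (by positivity))
      have h1 : a * c * (-(x + c)) ^ 2 ≤ a * (-y) * (-(y + c)) ^ 2 := by
        have : 0 ≤ -y := by linarith
        gcongr; linarith
      push_cast
      linarith
  obtain ⟨C, hC⟩ := isBounded_iff_forall_norm_le.mp (mem_filledJulia.mp hz)
  obtain ⟨n, hn⟩ := exists_nat_gt (C / (a * c * (-(x + c)) ^ 2))
  rw [div_lt_iff₀ (by positivity)] at hn
  obtain ⟨y, hy, hxy⟩ := hgrow n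
  have h2 := hC _ ⟨n, hy⟩
  rw [Complex.norm_real] at h2
  linarith [neg_le_abs y, Real.norm_eq_abs y]

theorem zero_mem_frontier_filledJulia (hc : 0 < c) (ha : 0 < a)
    (hf : ∀ z, f z = z + a * z * (z + c) ^ 2) : (0 : ℂ) ∈ frontier (filledJulia f) := by
  rw [frontier_eq_closure_inter_closure]
  refine ⟨subset_closure (mem_filledJulia_of_apply_eq (by simp [hf])), ?_⟩
  have h : (0 : ℝ) ∈ closure (Set.Ioi (0 : ℝ)) := by simp
  have := map_mem_closure Complex.continuous_ofReal h (t := (filledJulia f)ᶜ)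
    fun x hx => ofReal_notMem_filledJulia_of_pos hc ha hf hx
  simpa using this

theorem neg_mem_frontier_filledJulia (hc : 0 < c) (ha : 0 < a)
    (hf : ∀ z, f z = z + a * z * (z + c) ^ 2) : (-c : ℂ) ∈ frontier (filledJulia f) := by
  rw [frontier_eq_closure_inter_closure]
  refine ⟨subset_closure (mem_filledJulia_of_apply_eq (by simp [hf])), ?_⟩
  have h : -c ∈ closure (Set.Iio (-c)) := by simp
  have := map_mem_closure Complex.continuous_ofReal h (t := (filledJulia f)ᶜ)
    fun x hx => ofReal_notMem_filledJulia_of_lt_neg hc ha hf hx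
  simpa using this

/-- The hyperbola branch through the escaping critical point is mapped into the real ray
`(-∞, -c)`, so it misses the filled-in Julia set. -/
theorem notMem_filledJulia_of_hyperbola (hc : 0 < c) (ha : 0 < a)
    (hf : ∀ z, f z = z + a * z * (z + c) ^ 2) {z : ℂ} (hre : -c / 2 < z.re)
    (him : a * z.im ^ 2 = a * (3 * z.re ^ 2 + 4 * c * z.re + c ^ 2) + 1) :
    z ∉ filledJulia f := by
  intro hz
  obtain ⟨x, y⟩ := z
  simp only at hre him
  have hfz : f ⟨x, y⟩ = ((-2 * (x + c) * (a * (2 * x + c) ^ 2 + 1) : ℝ) : ℂ) := by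
    rw [hf]
    apply Complex.ext
    · simp [pow_two]
      linear_combination (-3 * x - 2 * c) * him
    · simp [pow_two]
      linear_combination (-y) * him
  refine ofReal_notMem_filledJulia_of_lt_neg hc ha hf ?_ (hfz ▸ apply_mem_filledJulia hz)
  nlinarith [mul_nonneg (by linarith : 0 ≤ x + c) (mul_nonneg ha.le (sq_nonneg (2 * x + c)))]

theorem not_isPreconnected_frontier_filledJulia (hc : 0 < c) (hac : 4 < a * c ^ 2)
    (hf : ∀ z, f z = z + a * z * (z + c) ^ 2) : ¬ IsPreconnected (frontier (filledJulia f)) := by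
  intro hpre
  have ha : 0 < a := pos_of_mul_pos_left (by linarith) (sq_nonneg c)
  let U : Set ℂ := {z | -c / 2 < z.re ∧
    a * z.im ^ 2 < a * (3 * z.re ^ 2 + 4 * c * z.re + c ^ 2) + 1}
  let W : Set ℂ := {z | z.re < -c / 2 ∨
    a * (3 * z.re ^ 2 + 4 * c * z.re + c ^ 2) + 1 < a * z.im ^ 2}
  have hU : IsOpen U := (isOpen_lt continuous_const Complex.continuous_re).inter
    (isOpen_lt
      (f := fun z : ℂ => a * z.im ^ 2)
      (g := fun z : ℂ => a * (3 * z.re ^ 2 + 4 * c * z.re + c ^ 2) + 1)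
      (by fun_prop) (by fun_prop))
  have hW : IsOpen W := (isOpen_lt Complex.continuous_re continuous_const).union
    (isOpen_lt
      (f := fun z : ℂ => a * (3 * z.re ^ 2 + 4 * c * z.re + c ^ 2) + 1)
      (g := fun z : ℂ => a * z.im ^ 2)
      (by fun_prop) (by fun_prop))
  have hcover : frontier (filledJulia f) ⊆ U ∪ W := by
    intro z hz
    have hzK := (isClosed_filledJulia_parabolicCubic hc hac hf).frontier_subset hz
    rcases lt_trichotomy z.re (-c / 2) with hre | hre | hre
    · exact Or.inr (Or.inl hre)
    · refine Or.inr (Or.inr ?_)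
      rw [hre]
      nlinarith [mul_nonneg ha.le (sq_nonneg z.im)]
    · rcases lt_trichotomy (a * z.im ^ 2)
        (a * (3 * z.re ^ 2 + 4 * c * z.re + c ^ 2) + 1) with him | him | him
      · exact Or.inl ⟨hre, him⟩
      · exact (notMem_filledJulia_of_hyperbola hc ha hf hre him hzK).elim
      · exact Or.inr (Or.inr him)
  obtain ⟨z, -, ⟨h1, h2⟩, h3⟩ := hpre U W hU hW hcover
    ⟨0, zero_mem_frontier_filledJulia hc ha hf, by
      refine ⟨by rw [Complex.zero_re]; linarith, ?_⟩
      simp only [Complex.zero_re, Complex.zero_im]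
      nlinarith⟩
    ⟨-c, neg_mem_frontier_filledJulia hc ha hf, Or.inl (by simp; linarith)⟩
  rcases h3 with h3 | h3 <;> linarith

/-- The attracting petal of the parabolic fixed point `-c`, the disc of radius `1 / (9 * a * c)`
tangent there to the vertical line, written in the coordinate `(z + c)⁻¹`. -/
theorem apply_mem_petal (hc : 0 < c) (hac : 4 < a * c ^ 2)
    (hf : ∀ z, f z = z + a * z * (z + c) ^ 2) {z : ℂ}
    (hz : 9 * a * c / 2 < ((z + c)⁻¹).re) : 9 * a * c / 2 < ((f z + c)⁻¹).re := by
  have ha : 0 < a := pos_of_mul_pos_left (by linarith) (sq_nonneg c)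
  obtain ⟨u, rfl⟩ : ∃ u, z = u - c := ⟨z + c, by ring⟩
  rw [sub_add_cancel] at hz
  have hu0 : u ≠ 0 := by
    rintro rfl
    simp at hz
    nlinarith [mul_pos ha hc]
  have hun : 0 < ‖u‖ := norm_pos_iff.mpr hu0
  have hu : 9 * (a * c) * ‖u‖ < 2 := by
    have h1 := hz.trans_le (Complex.re_le_norm _)
    rw [norm_inv] at h1
    have := mul_lt_mul_of_pos_right h1 hun
    rw [inv_mul_cancel₀ hun.ne'] at this
    linarith
  have huc : ‖u‖ ≤ c / 2 := by
    by_contra! h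
    nlinarith [mul_lt_mul_of_pos_left h (mul_pos ha hc)]
  have hre : |u.re| ≤ ‖u‖ := Complex.abs_re_le_norm u
  have hcu : (c : ℂ) - u ≠ 0 := by
    intro h
    have := congrArg Complex.re h
    simp at this
    linarith [le_abs_self u.re]
  have hpos : 0 < ((c - u)⁻¹ - a * u).re := by
    have h1 : ‖(c : ℂ) - u‖ ≤ 3 / 2 * c := by
      have := norm_sub_le (c : ℂ) u
      rw [Complex.norm_real, Real.norm_of_nonneg hc.le] at this
      linarith
    have h2 : 0 < Complex.normSq (c - u) := Complex.normSq_pos.mpr hcu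
    have h3 : Complex.normSq (c - u) ≤ (3 / 2 * c) ^ 2 := by
      rw [Complex.normSq_eq_norm_sq]
      gcongr
    have h4 : 2 / (9 * c) ≤ ((c - u)⁻¹).re := by
      rw [Complex.inv_re, div_le_div_iff₀ (by positivity) h2]
      simp
      nlinarith [le_abs_self u.re]
    have h5 : a * u.re < 2 / (9 * c) := by
      rw [lt_div_iff₀ (by positivity)]
      nlinarith [le_abs_self u.re, mul_pos ha hc]
    simp
    simp at h4
    linarith
  have hm : (c - u)⁻¹ - a * u ≠ 0 := by
    intro h
    simp [h] at hpos
  have hkey : (f (u - c) + c)⁻¹ = u⁻¹ + a * ((c - u)⁻¹ - a * u)⁻¹ := by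
    have hm' : 1 - a * u * (c - u) ≠ 0 := by
      intro h
      apply hm
      field_simp
      linear_combination h
    have e1 : f (u - c) + c = u * (1 - a * u * (c - u)) := by rw [hf]; ring
    have e2 : (c - u)⁻¹ - a * u = (1 - a * u * (c - u)) / (c - u) := by field_simp
    rw [e1, e2, inv_div, mul_inv, ← mul_div_assoc, eq_comm, ← sub_eq_zero]
    generalize hv : 1 - a * u * (c - u) = v at hm' ⊢
    field_simp
    linear_combination -hv
  rw [hkey, Complex.add_re, Complex.re_ofReal_mul]
  have : 0 ≤ a * (((c - u)⁻¹ - a * u)⁻¹).re := by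
    rw [Complex.inv_re]
    exact mul_nonneg ha.le (div_nonneg hpos.le (Complex.normSq_nonneg _))
  linarith

theorem interior_filledJulia_parabolicCubic_nonempty (hc : 0 < c) (hac : 4 < a * c ^ 2)
    (hf : ∀ z, f z = z + a * z * (z + c) ^ 2) : (interior (filledJulia f)).Nonempty := by
  have ha : 0 < a := pos_of_mul_pos_left (by linarith) (sq_nonneg c)
  have hsub : {z : ℂ | 9 * a * c / 2 < ((z + c)⁻¹).re} ⊆ filledJulia f := by
    intro z hz
    have hiter : ∀ n, f^[n] z ∈ {z : ℂ | 9 * a * c / 2 < ((z + c)⁻¹).re} := by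
      intro n
      induction n with
      | zero => exact hz
      | succ n ih =>
        rw [Function.iterate_succ_apply']
        exact apply_mem_petal hc hac hf ih
    refine mem_filledJulia.mpr <| isBounded_iff_forall_norm_le.mpr ⟨(9 * a * c / 2)⁻¹ + c, ?_⟩
    rintro _ ⟨n, rfl⟩
    have h1 := (Set.mem_ofPred.mp (hiter n)).le.trans (Complex.re_le_norm _)
    rw [norm_inv] at h1
    have h2 := inv_anti₀ (by positivity) h1
    rw [inv_inv] at h2
    have h3 := norm_sub_le (f^[n] z + c) c
    rw [add_sub_cancel_right, Complex.norm_real, Real.norm_of_nonneg hc.le] at h3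
    linarith
  refine ⟨(((9 * a * c)⁻¹ : ℝ) : ℂ) - c, mem_interior_iff_mem_nhds.mpr
    (Filter.mem_of_superset ?_ hsub)⟩
  have hr : (((9 * a * c)⁻¹ : ℝ) : ℂ) ≠ 0 := Complex.ofReal_ne_zero.mpr (by positivity)
  have hcont : ContinuousAt (fun z : ℂ => ((z + c)⁻¹).re) ((((9 * a * c)⁻¹ : ℝ) : ℂ) - c) :=
    Complex.continuous_re.continuousAt.comp
      (ContinuousAt.inv₀ (by fun_prop) (by rwa [sub_add_cancel]))
  refine hcont.preimage_mem_nhds (Ioi_mem_nhds ?_)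
  rw [sub_add_cancel, ← Complex.ofReal_inv, Complex.ofReal_re, inv_inv]
  exact half_lt_self (by positivity)

end ParabolicCubic


/-- For a finite simple graph with independence number 3 whose reduced
independence polynomial is `P(z) = a₁z + a₂z² + a₃z³`, if `a₂² > 3·a₁·a₃`,
`a₂² = 4·a₃·(a₁ − 1)` and `a₁ > 5`, then the Julia set of `P` is not connected but
not totally disconnected: it contains a connected subset with two distinct points. -/
theorem stmt_5 {V : Type*} [Fintype V] [DecidableEq V]
    (G : SimpleGraph V) [DecidableRel G.Adj]
    (a₁ a₂ a₃ : ℕ)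
    (ha₁ : a₁ = Fintype.card V)
    (ha₂ : a₂ = (Finset.univ.filter
      (fun s : Finset V => s.card = 2 ∧ ∀ u ∈ s, ∀ v ∈ s, ¬ G.Adj u v)).card)
    (ha₃ : a₃ = (Finset.univ.filter
      (fun s : Finset V => s.card = 3 ∧ ∀ u ∈ s, ∀ v ∈ s, ¬ G.Adj u v)).card)
    (hindep3 : ∃ s : Finset V, s.card = 3 ∧ ∀ u ∈ s, ∀ v ∈ s, ¬ G.Adj u v)
    (hindep4 : ¬ ∃ s : Finset V, s.card = 4 ∧ ∀ u ∈ s, ∀ v ∈ s, ¬ G.Adj u v)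
    (P : ℂ → ℂ)
    (hP : ∀ z, P z = a₁ * z + a₂ * z ^ 2 + a₃ * z ^ 3)
    (hgt : (3 * a₁ * a₃ : ℤ) < (a₂ : ℤ) ^ 2)
    (heq : (a₂ : ℤ) ^ 2 = 4 * a₃ * ((a₁ : ℤ) - 1))
    (ha : 5 < a₁) :
    ¬ IsConnected
        (frontier {z : ℂ | Bornology.IsBounded (Set.range fun n => P^[n] z)}) ∧
      ∃ t ⊆ frontier {z : ℂ | Bornology.IsBounded (Set.range fun n => P^[n] z)},
        IsPreconnected t ∧ ∃ x ∈ t, ∃ y ∈ t, x ≠ y := by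
  have ha₂' : 0 < a₂ := by
    rcases Nat.eq_zero_or_pos a₂ with h | h
    · rw [h] at hgt
      have : (0 : ℤ) ≤ 3 * a₁ * a₃ := by positivity
      simp only [Nat.cast_zero] at hgt
      linarith
    · exact h
  have ha₃' : 0 < a₃ := by
    rw [ha₃]
    obtain ⟨s, hs⟩ := hindep3
    exact Finset.card_pos.mpr ⟨s, by simpa using hs⟩
  have h3 : (0 : ℝ) < a₃ := Nat.cast_pos.mpr ha₃'
  have hc : (0 : ℝ) < a₂ / (2 * a₃) := div_pos (Nat.cast_pos.mpr ha₂') (by positivity)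
  have heq' : (a₂ : ℝ) ^ 2 = 4 * a₃ * (a₁ - 1) := by exact_mod_cast heq
  have hac' : (a₃ : ℝ) * (a₂ / (2 * a₃)) ^ 2 = a₁ - 1 := by
    rw [div_pow, heq']
    field_simp
    ring
  have hac : (4 : ℝ) < a₃ * (a₂ / (2 * a₃)) ^ 2 := by
    have : (5 : ℝ) < a₁ := by exact_mod_cast ha
    linarith
  have hf : ∀ z, P z = z + (a₃ : ℝ) * z * (z + ((a₂ / (2 * a₃) : ℝ) : ℂ)) ^ 2 := by
    intro z
    have h1 : (a₃ : ℂ) * (a₂ / (2 * a₃)) ^ 2 = a₁ - 1 := by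
      simpa using congrArg ((↑) : ℝ → ℂ) hac'
    have h2 : (a₃ : ℂ) * (a₂ / (2 * a₃)) = a₂ / 2 := by
      have : (a₃ : ℂ) ≠ 0 := Nat.cast_ne_zero.mpr ha₃'.ne'
      field_simp
    rw [hP]
    push_cast
    linear_combination (-z) * h1 - 2 * z ^ 2 * h2
  refine ⟨fun h => not_isPreconnected_frontier_filledJulia hc hac hf h.isPreconnected, ?_⟩
  have htd := not_isTotallyDisconnected_frontier
    (isBounded_filledJulia_parabolicCubic hc hac hf)
    (interior_filledJulia_parabolicCubic_nonempty hc hac hf)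
  simp only [IsTotallyDisconnected, not_forall, Set.not_subsingleton_iff] at htd
  obtain ⟨t, hts, htc, x, hx, y, hy, hxy⟩ := htd
  exact ⟨t, hts, htc, x, hx, y, hy, hxy⟩
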